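/- Let w ∈ ℂ∖{0} and α > 0. Then lim_{z→0, z≠0} [ζ(z+1)·A_w(z)/(2α^{z+1}) + ζ(z)·A_w(−z)/(αz)] = ((γ − log(2πα))/(2α))·C(w) + B(w)/(2α). -/

import Mathlib

noncomputable section
open Complex MeasureTheory Set Filter Topology

/-- Pochhammer symbol `(a)_n`. -/
def poch (a : ℂ) (n : ℕ) : ℂ := (ascPochhammer ℂ n).eval a

/-- Confluent hypergeometric function `₁F₁(a; c; z)`. -/
def oneF1 (a c z : ℂ) : ℂ := ∑' n : ℕ, poch a n / poch c n * z ^ n / (n.factorial : ℂ)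

/-- Complex error function, defined by integrating along the segment from `0` to `w`. -/
def cerf (w : ℂ) : ℂ :=
  (2 / (Real.sqrt Real.pi : ℂ)) * ∫ t in (0:ℝ)..1, w * Complex.exp (-(t * w) ^ 2)

/-- Complex imaginary error function. -/
def cerfi (w : ℂ) : ℂ :=
  (2 / (Real.sqrt Real.pi : ℂ)) * ∫ t in (0:ℝ)..1, w * Complex.exp ((t * w) ^ 2)

/-- Digamma function `ψ = Γ'/Γ`. -/
def digam (x : ℝ) : ℝ := deriv Real.Gamma x / Real.Gamma x

/-- The function `C(w) = (π/w²) e^{w²/4} erf²(w/2)`. -/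
def Cfun (w : ℂ) : ℂ := ((Real.pi : ℂ) / w ^ 2) * Complex.exp (w ^ 2 / 4) * (cerf (w / 2)) ^ 2

/-- The function `B(w)`. -/
def Bfun (w : ℂ) : ℂ := ((Real.sqrt Real.pi : ℂ) / w) * cerf (w / 2) *
  ∑' n : ℕ, (w ^ 2 / 4) ^ n / poch (3/2) n * ((digam (n + 1) : ℂ) + (Real.eulerMascheroniConstant : ℂ))


/-- `A_w(z) = (√π/w) erf(w/2) ₁F₁(1 + z/2; 3/2; w²/4)`. -/
def Afun (w z : ℂ) : ℂ :=
  ((Real.sqrt Real.pi : ℂ) / w) * cerf (w / 2) * oneF1 (1 + z / 2) (3/2) (w ^ 2 / 4)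


lemma poch_zero (a : ℂ) : poch a 0 = 1 := by simp [poch]

lemma poch_succ (a : ℂ) (n : ℕ) : poch a (n + 1) = poch a n * (a + n) := by
  simp [poch, ascPochhammer_succ_eval]

lemma poch_one (n : ℕ) : poch 1 n = (n.factorial : ℂ) := by
  simp [poch, ascPochhammer_eval_one]

lemma poch_half_norm (n : ℕ) : (n.factorial : ℝ) ≤ ‖poch (3/2) n‖ := by
  induction n with
  | zero => simp [poch_zero]
  | succ n ih =>
    rw [poch_succ, norm_mul, Nat.factorial_succ]
    have h : ‖(3/2 : ℂ) + n‖ = 3/2 + n := by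
      have : (3/2 : ℂ) + n = ((3/2 + n : ℝ) : ℂ) := by push_cast; ring
      rw [this, Complex.norm_real, Real.norm_of_nonneg (by positivity)]
    rw [h]
    push_cast
    have h0 : (0:ℝ) ≤ n := by positivity
    rw [mul_comm]
    exact mul_le_mul ih (by linarith) (by positivity) (norm_nonneg _)

lemma poch_half_ne (n : ℕ) : poch (3/2) n ≠ 0 := by
  have := poch_half_norm n
  have h2 : (0:ℝ) < n.factorial := by positivity
  exact norm_pos_iff.1 (h2.trans_le this)

lemma poch_bound (z : ℂ) (hz : ‖z‖ < 1) (n : ℕ) :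
    ‖poch (1 + z / 2) n‖ ≤ (2:ℝ) ^ n * n.factorial := by
  induction n with
  | zero => simp [poch_zero]
  | succ n ih =>
    rw [poch_succ, norm_mul, Nat.factorial_succ]
    have h : ‖(1 + z / 2 : ℂ) + n‖ ≤ 2 * (n + 1) := by
      calc ‖(1 + z / 2 : ℂ) + n‖ ≤ ‖(1:ℂ)‖ + ‖z / 2‖ + ‖(n:ℂ)‖ := norm_add₃_le
        _ = 1 + ‖z‖ / 2 + n := by simp
        _ ≤ 2 * (n + 1) := by
          have : (0:ℝ) ≤ n := by positivity
          linarith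
    calc _ ≤ ((2:ℝ) ^ n * n.factorial) * (2 * (n + 1)) := by gcongr
      _ = _ := by push_cast; ring

lemma poch_hasDerivAt (n : ℕ) :
    HasDerivAt (fun z : ℂ => poch (1 + z / 2) n) (n.factorial * (harmonic n : ℂ) / 2) 0 := by
  induction n with
  | zero => simpa [poch_zero] using hasDerivAt_const (0:ℂ) (1:ℂ)
  | succ n ih =>
    simp only [poch_succ]
    have h : HasDerivAt (fun z : ℂ => 1 + z / 2 + n) (1 / 2) 0 :=
      (((hasDerivAt_id (0:ℂ)).div_const 2).const_add 1).add_const _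
    refine (ih.mul h).congr_deriv ?_
    have : (n : ℂ) + 1 ≠ 0 := by exact_mod_cast n.succ_ne_zero
    simp only [zero_div, add_zero, poch_one, harmonic_succ, Nat.factorial_succ]
    push_cast
    field_simp
    ring

lemma poch_diff (n : ℕ) : Differentiable ℂ (fun z : ℂ => poch (1 + z / 2) n) := by
  induction n with
  | zero => simp [poch_zero]
  | succ n ih =>
    simp only [poch_succ]
    fun_prop

lemma digam_add (n : ℕ) : (digam (n + 1) : ℂ) + (Real.eulerMascheroniConstant : ℂ)
    = (harmonic n : ℂ) := by
  have : digam (n + 1) = -Real.eulerMascheroniConstant + harmonic n := by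
    rw [digam, Real.deriv_Gamma_nat, Real.Gamma_nat_eq_factorial]
    have : (n.factorial : ℝ) ≠ 0 := by positivity
    field_simp
  rw [this]
  push_cast
  ring

lemma oneF1_hasDerivAt (x : ℂ) :
    HasDerivAt (fun z : ℂ => oneF1 (1 + z / 2) (3/2) x)
      ((∑' n : ℕ, x ^ n / poch (3/2) n *
        ((digam (n + 1) : ℂ) + (Real.eulerMascheroniConstant : ℂ))) / 2) 0 := by
  unfold oneF1
  set F : ℕ → ℂ → ℂ := fun n z =>
    poch (1 + z / 2) n / poch (3/2) n * x ^ n / (n.factorial : ℂ) with hF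
  have hu : Summable (fun n : ℕ => (2 * ‖x‖) ^ n / (n.factorial : ℝ)) :=
    Real.summable_pow_div_factorial _
  have hd : ∀ n, DifferentiableOn ℂ (F n) (Metric.ball 0 1) := by
    intro n
    have := poch_diff n
    exact ((((this.div_const _).mul_const _).div_const _)).differentiableOn
  have hle : ∀ (n : ℕ) (z : ℂ), z ∈ Metric.ball (0:ℂ) 1 →
      ‖F n z‖ ≤ (2 * ‖x‖) ^ n / (n.factorial : ℝ) := by
    intro n z hz
    have hz : ‖z‖ < 1 := by simpa using hz
    have h0 : (0:ℝ) < n.factorial := by positivity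
    simp only [hF, norm_div, norm_mul, norm_pow, Complex.norm_natCast]
    gcongr
    rw [mul_pow]
    gcongr
    rw [div_le_iff₀ (h0.trans_le (poch_half_norm n))]
    refine (poch_bound z hz n).trans ?_
    gcongr
    exact poch_half_norm n
  have h0 : (0:ℂ) ∈ Metric.ball (0:ℂ) 1 := by simp
  have hs := Complex.hasSum_deriv_of_summable_norm hu hd Metric.isOpen_ball hle h0
  have hdiff := (Complex.differentiableOn_tsum_of_summable_norm hu hd Metric.isOpen_ball
    hle).differentiableAt (Metric.isOpen_ball.mem_nhds h0)
  refine hdiff.hasDerivAt.congr_deriv ?_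
  rw [← hs.tsum_eq, ← tsum_div_const]
  refine tsum_congr fun n => ?_
  have := (((poch_hasDerivAt n).div_const (poch (3/2) n)).mul_const (x ^ n)).div_const
    (n.factorial : ℂ)
  rw [this.deriv, digam_add]
  have h1 : (n.factorial : ℂ) ≠ 0 := by exact_mod_cast n.factorial_ne_zero
  have := poch_half_ne n
  field_simp

lemma integral_one_sub_sq_pow (n : ℕ) :
    ∫ t in (0:ℝ)..1, (1 - (t:ℂ) ^ 2) ^ n = (n.factorial : ℂ) / poch (3/2) n := by
  induction n with
  | zero => simp [poch_zero]
  | succ n ih =>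
    have hder : ∀ t : ℝ, HasDerivAt (fun t : ℝ => (t : ℂ) * (1 - (t:ℂ) ^ 2) ^ (n + 1))
        ((2 * n + 3) * (1 - (t:ℂ) ^ 2) ^ (n + 1) - (2 * (n + 1)) * (1 - (t:ℂ) ^ 2) ^ n) t := by
      intro t
      have h := (hasDerivAt_id (t:ℂ)).mul
        ((((hasDerivAt_id (t:ℂ)).pow 2).const_sub 1).pow (n + 1))
      refine (h.comp_ofReal).congr_deriv ?_
      simp
      ring
    have hi := intervalIntegral.integral_eq_sub_of_hasDerivAt (a := 0) (b := 1)
      (fun t _ => hder t) (Continuous.intervalIntegrable (by fun_prop) _ _)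
    rw [intervalIntegral.integral_sub (Continuous.intervalIntegrable (by fun_prop) _ _)
      (Continuous.intervalIntegrable (by fun_prop) _ _),
      intervalIntegral.integral_const_mul, intervalIntegral.integral_const_mul, ih] at hi
    simp only [Complex.ofReal_one, Complex.ofReal_zero, one_pow, sub_self, ne_eq,
      Nat.succ_ne_zero, not_false_eq_true, zero_pow, mul_zero, zero_mul] at hi
    have h3 : (3/2 : ℂ) + n ≠ 0 := by
      intro h
      apply poch_half_ne (n + 1)
      rw [poch_succ, h, mul_zero]
    rw [poch_succ, Nat.factorial_succ]
    have hp := poch_half_ne n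
    push_cast
    rw [eq_div_iff (mul_ne_zero hp h3)]
    field_simp at hi
    linear_combination hi / 2

lemma kummer (x : ℂ) : oneF1 1 (3/2) x
    = ∫ t in (0:ℝ)..1, Complex.exp ((1 - (t:ℂ) ^ 2) * x) := by
  have h : HasSum (fun n : ℕ => ∫ t in (0:ℝ)..1, ((1 - (t:ℂ) ^ 2) * x) ^ n / (n.factorial : ℂ))
      (∫ t in (0:ℝ)..1, Complex.exp ((1 - (t:ℂ) ^ 2) * x)) := by
    refine intervalIntegral.hasSum_integral_of_dominated_convergence
      (fun n _ => ‖x‖ ^ n / (n.factorial : ℝ)) ?_ ?_ ?_ ?_ ?_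
    · intro n
      exact Continuous.aestronglyMeasurable (by fun_prop)
    · intro n
      refine Eventually.of_forall fun t ht => ?_
      rw [uIoc_of_le zero_le_one] at ht
      rw [norm_div, norm_pow, norm_mul, Complex.norm_natCast]
      gcongr
      have : (1 - (t:ℂ) ^ 2) = ((1 - t ^ 2 : ℝ) : ℂ) := by push_cast; ring
      rw [this, Complex.norm_real]
      have h1 : ‖1 - t ^ 2‖ ≤ 1 := by
        rw [Real.norm_eq_abs, abs_le]
        constructor <;> nlinarith [ht.1, ht.2]
      exact mul_le_of_le_one_left (norm_nonneg _) h1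
    · exact Eventually.of_forall fun t _ => Real.summable_pow_div_factorial _
    · exact Continuous.intervalIntegrable (by fun_prop) _ _
    · refine Eventually.of_forall fun t _ => ?_
      rw [Complex.exp_eq_exp_ℂ]
      exact NormedSpace.expSeries_div_hasSum_exp _
  rw [← h.tsum_eq, oneF1]
  refine tsum_congr fun n => ?_
  have h1 : (n.factorial : ℂ) ≠ 0 := by exact_mod_cast n.factorial_ne_zero
  have := poch_half_ne n
  simp only [mul_pow]
  rw [intervalIntegral.integral_div, intervalIntegral.integral_mul_const, integral_one_sub_sq_pow, poch_one]

lemma Afun_zero (w : ℂ) (hw : w ≠ 0) : Afun w 0 = Cfun w := by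
  have hpi : ((Real.sqrt Real.pi : ℝ) : ℂ) ≠ 0 := by
    exact_mod_cast (Real.sqrt_pos.2 Real.pi_pos).ne'
  have hpi2 : ((Real.sqrt Real.pi : ℝ) : ℂ) ^ 2 = (Real.pi : ℂ) := by
    exact_mod_cast Real.sq_sqrt Real.pi_pos.le
  have key : oneF1 1 (3/2) (w ^ 2 / 4)
      = (Real.sqrt Real.pi : ℂ) / w * Complex.exp (w ^ 2 / 4) * cerf (w / 2) := by
    rw [kummer, cerf, intervalIntegral.integral_const_mul]
    have : ∀ t : ℝ, Complex.exp ((1 - (t:ℂ) ^ 2) * (w ^ 2 / 4))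
        = Complex.exp (w ^ 2 / 4) * Complex.exp (-(t * (w / 2)) ^ 2) := by
      intro t
      rw [← Complex.exp_add]
      congr 1
      ring
    simp only [this]
    rw [intervalIntegral.integral_const_mul]
    field_simp
  rw [Afun, zero_div, add_zero, key, Cfun, ← hpi2]
  field_simp

lemma Afun_hasDerivAt (w : ℂ) : HasDerivAt (Afun w) (Bfun w / 2) 0 := by
  unfold Afun Bfun
  refine ((oneF1_hasDerivAt (w ^ 2 / 4)).const_mul _).congr_deriv ?_
  ring

/-- The limit `L₁(w, α)` evaluated in the proof of Theorem 1.4 of Dixit–Kumar. -/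
theorem limit_L1 (w : ℂ) (hw : w ≠ 0) (α : ℝ) (hα : 0 < α) :
    Tendsto (fun z : ℂ =>
        riemannZeta (z + 1) * Afun w z / (2 * (α:ℂ) ^ (z + 1))
          + riemannZeta z * Afun w (-z) / ((α:ℂ) * z))
      (𝓝[≠] (0 : ℂ))
      (𝓝 ((((Real.eulerMascheroniConstant - Real.log (2 * Real.pi * α)) / (2 * α) : ℝ) : ℂ)
            * Cfun w + Bfun w / (2 * α))) := by
  have hα0 : (α : ℂ) ≠ 0 := by exact_mod_cast hα.ne'
  have hA := Afun_hasDerivAt w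
  have hA' : HasDerivAt (fun z => Afun w (-z)) (-(Bfun w / 2)) 0 := by
    have h := HasDerivAt.scomp (0:ℂ) (h := fun z : ℂ => -z) (by simpa using hA)
      (hasDerivAt_neg (0:ℂ))
    refine h.congr_deriv ?_
    simp
  have hz1 : HasDerivAt (fun z : ℂ => riemannZeta₁ (z + 1))
      (Real.eulerMascheroniConstant : ℂ) 0 := by
    apply HasDerivAt.comp_add_const
    rw [zero_add, ← deriv_riemannZeta₁_one]
    exact (differentiable_riemannZeta₁ 1).hasDerivAt
  have hz0 : HasDerivAt riemannZeta (-Complex.log (2 * Real.pi) / 2) 0 := by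
    rw [← deriv_riemannZeta_zero]
    exact (differentiableAt_riemannZeta (by norm_num)).hasDerivAt
  have hp : HasDerivAt (fun z : ℂ => 2 * (α:ℂ) ^ (z + 1)) (2 * (α * Complex.log α)) 0 := by
    have h := (((hasDerivAt_id (0:ℂ)).add_const 1).const_cpow (c := (α:ℂ)) (Or.inl hα0)).const_mul 2
    refine h.congr_deriv ?_
    simp
  have hG := ((hz1.mul hA).div hp (by simpa using hα0)).add ((hz0.mul hA').div_const (α:ℂ))
  rw [hasDerivAt_iff_tendsto_slope] at hG
  have hlog : Complex.log (2 * Real.pi) = (Real.log (2 * Real.pi) : ℂ) := by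
    rw [Complex.ofReal_log (by positivity)]
    push_cast
    rfl
  have hlog2 : Real.log (2 * Real.pi * α) = Real.log (2 * Real.pi) + Real.log α :=
    Real.log_mul (by positivity) hα.ne'
  refine (hG.congr' ?_).trans_eq ?_
  · filter_upwards [self_mem_nhdsWithin] with z hz
    have hz : z ≠ 0 := hz
    have hne : (α:ℂ) ^ (z + 1) ≠ 0 := by simp [Complex.cpow_eq_zero_iff, hα0]
    rw [slope_def_field, riemannZeta_eq_inv_sub_mul (s := z + 1) (by simpa using hz)]
    simp [riemannZeta_zero]
    field_simp
    ring
  · congr 1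
    rw [hlog2, hlog, ← Complex.ofReal_log hα.le, ← Afun_zero w hw]
    simp [riemannZeta_zero]
    field_simp
    ring
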